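/- Let σ₀ determine a strictly weak, graded Riemannian metric on a Hilbertian H-type group M = V ⊕ W, and let z ∈ W with z ≠ 0. For any sequence (w_n) in V with |w_n| = 1 for all n and ‖w_n‖_{σ₀} → 0, define ξ_n = J_z w_n − (σ₀(J_z w_n, w_n)/‖w_n‖²_{σ₀}) w_n. Then ξ_n ≠ 0, [w_n, ξ_n] = z, and the quantity ‖z‖²_{σ₀} / (‖w_n‖²_{σ₀} ‖ξ_n‖²_{σ₀}) tends to +∞ as n → ∞; consequently the sectional curvature of the plane spanned by w_n and J_z w_n, which by Arnold's formula equals −(3/4) ‖z‖²_{σ₀} / (‖w_n‖²_{σ₀} ‖ξ_n‖²_{σ₀}), tends to −∞. -/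

import Mathlib

open scoped RealInnerProductSpace

/-- A Hilbertian H-type group: a real Hilbert space `M` with an orthogonal decomposition
`M = V ⊕ W` into nontrivial closed subspaces, `W` finite dimensional, a continuous
skew-symmetric Lie bracket with `[M,M] ⊆ W`, `[M,W] = 0`, and the map `J` determined by
`⟪J z x, y⟫ = ⟪z, [x,y]⟫` satisfying `J_z ∘ J_z = -‖z‖² id` on `V`. -/
structure HTypeGroup (M : Type*) [NormedAddCommGroup M] [InnerProductSpace ℝ M]
    [CompleteSpace M] where
  V : Submodule ℝ M
  W : Submodule ℝ M
  V_closed : IsClosed (V : Set M)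
  W_closed : IsClosed (W : Set M)
  V_nontrivial : V ≠ ⊥
  W_nontrivial : W ≠ ⊥
  W_findim : FiniteDimensional ℝ ↥W
  orthogonal : ∀ v ∈ V, ∀ w ∈ W, ⟪v, w⟫ = 0
  proj1 : M →L[ℝ] M
  proj2 : M →L[ℝ] M
  proj1_mem : ∀ v : M, proj1 v ∈ V
  proj2_mem : ∀ v : M, proj2 v ∈ W
  proj_add : ∀ v : M, proj1 v + proj2 v = v
  bracket : M →L[ℝ] M →L[ℝ] M
  bracket_skew : ∀ u v : M, bracket u v = - bracket v u
  bracket_mem_W : ∀ u v : M, bracket u v ∈ W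
  bracket_W : ∀ u : M, ∀ w ∈ W, bracket u w = 0
  Jmap : M →L[ℝ] M →L[ℝ] M
  Jmap_mem_V : ∀ z ∈ W, ∀ x ∈ V, Jmap z x ∈ V
  Jmap_inner : ∀ z ∈ W, ∀ x ∈ V, ∀ y ∈ V, ⟪Jmap z x, y⟫ = ⟪z, bracket x y⟫
  Jmap_sq : ∀ z ∈ W, ∀ x ∈ V, Jmap z (Jmap z x) = -(‖z‖ ^ 2) • x

namespace HTypeGroup

variable {M : Type*} [NormedAddCommGroup M] [InnerProductSpace ℝ M] [CompleteSpace M]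
  (H : HTypeGroup M)

theorem bracket_self (u : M) : H.bracket u u = 0 := by
  have : IsAddTorsionFree M := .of_isTorsionFree ℝ M
  exact self_eq_neg.mp (H.bracket_skew u u)

theorem Jmap_inner_comm {z x y : M} (hz : z ∈ H.W) (hx : x ∈ H.V) (hy : y ∈ H.V) :
    ⟪H.Jmap z x, y⟫ = -⟪H.Jmap z y, x⟫ := by
  rw [H.Jmap_inner z hz x hx y hy, H.Jmap_inner z hz y hy x hx, H.bracket_skew, inner_neg_right]

theorem Jmap_inner_self {z x : M} (hz : z ∈ H.W) (hx : x ∈ H.V) :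
    ⟪H.Jmap z x, H.Jmap z x⟫ = ‖z‖ ^ 2 * ‖x‖ ^ 2 := by
  rw [H.Jmap_inner_comm hz hx (H.Jmap_mem_V z hz x hx), H.Jmap_sq z hz x hx, inner_smul_left,
    real_inner_self_eq_norm_sq]
  simp

theorem norm_Jmap {z x : M} (hz : z ∈ H.W) (hx : x ∈ H.V) :
    ‖H.Jmap z x‖ = ‖z‖ * ‖x‖ := by
  have h := H.Jmap_inner_self hz hx
  rw [real_inner_self_eq_norm_sq, ← mul_pow] at h
  exact (sq_eq_sq₀ (norm_nonneg _) (by positivity)).mp h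

theorem Jmap_inner_Jmap {z z' x : M} (hz : z ∈ H.W) (hz' : z' ∈ H.W) (hx : x ∈ H.V) :
    ⟪H.Jmap z x, H.Jmap z' x⟫ = ⟪z, z'⟫ * ‖x‖ ^ 2 := by
  have h := H.Jmap_inner_self (H.W.add_mem hz hz') hx
  rw [map_add, add_apply, real_inner_add_add_self, H.Jmap_inner_self hz hx,
    H.Jmap_inner_self hz' hx, norm_add_sq_real] at h
  linarith

theorem bracket_Jmap {z x : M} (hz : z ∈ H.W) (hx : x ∈ H.V) :
    H.bracket x (H.Jmap z x) = ‖x‖ ^ 2 • z := by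
  have h : ∀ u ∈ H.W, ⟪u, H.bracket x (H.Jmap z x) - ‖x‖ ^ 2 • z⟫ = 0 := by
    intro u hu
    rw [inner_sub_right, ← H.Jmap_inner u hu x hx _ (H.Jmap_mem_V z hz x hx),
      H.Jmap_inner_Jmap hu hz hx, real_inner_smul_right]
    ring
  exact sub_eq_zero.mp (inner_self_eq_zero.mp
    (h _ (H.W.sub_mem (H.bracket_mem_W _ _) (H.W.smul_mem _ hz))))

end HTypeGroup

/-- Subtracting from `x` its `σ`-projection onto `w` does not increase `σ x x`. -/
theorem bilin_sub_proj_self_le {M : Type*} [AddCommGroup M] [Module ℝ M] {σ : M → M → ℝ}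
    (h_bilin : ∀ v : M, IsLinearMap ℝ (σ v) ∧ IsLinearMap ℝ (fun w => σ w v))
    (h_symm : ∀ v w : M, σ v w = σ w v) (x : M) {w : M} (hw : 0 < σ w w) :
    σ (x - (σ x w / σ w w) • w) (x - (σ x w / σ w w) • w) ≤ σ x x := by
  have h_left : ∀ (c : ℝ) (y : M), σ (x - c • w) y = σ x y - c * σ w y := fun c y => by
    simpa using ((h_bilin y).2.map_sub x (c • w)).trans
      (congrArg (σ x y - ·) ((h_bilin y).2.map_smul c w))
  have h_right : ∀ (c : ℝ) (y : M), σ y (x - c • w) = σ y x - c * σ y w := fun c y => by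
    rw [(h_bilin y).1.map_sub, (h_bilin y).1.map_smul, smul_eq_mul]
  rw [h_left, h_right, h_right, h_symm w x]
  have h : σ x w / σ w w * σ w w = σ x w := div_mul_cancel₀ _ hw.ne'
  have h_nonneg : 0 ≤ σ x w / σ w w * σ x w := by
    rw [div_mul_eq_mul_div]
    exact div_nonneg (mul_self_nonneg _) hw.le
  rw [h]
  linarith

/-- Let `σ₀` determine a strictly weak, graded Riemannian metric on a
Hilbertian H-type group `M = V ⊕ W` and let `z ∈ W`, `z ≠ 0`. For a sequence `(w_n)` in `V`
with `‖w_n‖ = 1` and `‖w_n‖_{σ₀} → 0`, set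
`ξ_n = J_z w_n − (σ₀(J_z w_n, w_n)/‖w_n‖²_{σ₀}) • w_n`. Then `ξ_n ≠ 0`, `[w_n, ξ_n] = z`,
and `‖z‖²_{σ₀}/(‖w_n‖²_{σ₀} ‖ξ_n‖²_{σ₀}) → +∞`; consequently the sectional curvature
`−(3/4) ‖z‖²_{σ₀}/(‖w_n‖²_{σ₀} ‖ξ_n‖²_{σ₀})` of the plane spanned by `w_n, J_z w_n`
tends to `−∞`. -/
theorem statement_18 {M : Type*} [NormedAddCommGroup M] [InnerProductSpace ℝ M]
    [CompleteSpace M] (H : HTypeGroup M) (σ : M → M → ℝ)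
    (h_bilin : ∀ v : M, IsLinearMap ℝ (σ v) ∧ IsLinearMap ℝ (fun w => σ w v))
    (h_symm : ∀ v w : M, σ v w = σ w v)
    (h_posdef : ∀ v : M, v ≠ 0 → 0 < σ v v)
    (c₀ : ℝ) (hc₀ : 0 < c₀)
    (h_cont : ∀ v : M, Real.sqrt (σ v v) ≤ c₀ * ‖v‖)
    (h_graded : ∀ v ∈ H.V, ∀ w ∈ H.W, σ v w = 0)
    (h_strictly_weak : ¬ ∃ c > (0 : ℝ), ∀ v : M, c * ‖v‖ ≤ Real.sqrt (σ v v))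
    (z : M) (hz : z ∈ H.W) (hz0 : z ≠ 0)
    (w : ℕ → M) (hwV : ∀ n, w n ∈ H.V) (hw1 : ∀ n, ‖w n‖ = 1)
    (hw0 : Filter.Tendsto (fun n => Real.sqrt (σ (w n) (w n))) Filter.atTop (nhds 0))
    (ξ : ℕ → M)
    (hξ : ∀ n, ξ n = H.Jmap z (w n) - (σ (H.Jmap z (w n)) (w n) / σ (w n) (w n)) • w n) :
    (∀ n, ξ n ≠ 0) ∧
    (∀ n, H.bracket (w n) (ξ n) = z) ∧
    Filter.Tendsto (fun n => σ z z / (σ (w n) (w n) * σ (ξ n) (ξ n)))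
      Filter.atTop Filter.atTop ∧
    Filter.Tendsto (fun n => -(3 / 4 : ℝ) * (σ z z / (σ (w n) (w n) * σ (ξ n) (ξ n))))
      Filter.atTop Filter.atBot := by
  have h_bracket : ∀ n, H.bracket (w n) (ξ n) = z := fun n => by
    rw [hξ, map_sub, map_smul, H.bracket_self, H.bracket_Jmap hz (hwV n), hw1]
    simp
  have hξ0 : ∀ n, ξ n ≠ 0 := fun n h => hz0 (by rw [← h_bracket n, h, map_zero])
  have hw_pos : ∀ n, 0 < σ (w n) (w n) := fun n =>
    h_posdef _ (norm_ne_zero_iff.mp (by rw [hw1]; exact one_ne_zero))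
  have hξ_le : ∀ n, σ (ξ n) (ξ n) ≤ (c₀ * ‖z‖) ^ 2 := fun n => by
    have h := h_cont (H.Jmap z (w n))
    rw [H.norm_Jmap hz (hwV n), hw1, mul_one] at h
    rw [hξ]
    exact (bilin_sub_proj_self_le h_bilin h_symm _ (hw_pos n)).trans
      ((Real.sqrt_le_left (by positivity)).mp h)
  have hw_lim : Filter.Tendsto (fun n => σ (w n) (w n)) Filter.atTop (nhds 0) := by
    simpa [Real.sq_sqrt (hw_pos _).le] using hw0.pow 2
  have h_prod : Filter.Tendsto (fun n => σ (w n) (w n) * σ (ξ n) (ξ n)) Filter.atTop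
      (nhdsWithin 0 (Set.Ioi 0)) := by
    have h_pos : ∀ n, 0 < σ (w n) (w n) * σ (ξ n) (ξ n) := fun n =>
      mul_pos (hw_pos n) (h_posdef _ (hξ0 n))
    refine tendsto_nhdsWithin_iff.mpr ⟨?_, Filter.Eventually.of_forall h_pos⟩
    refine squeeze_zero (fun n => (h_pos n).le)
      (fun n => mul_le_mul_of_nonneg_left (hξ_le n) (hw_pos n).le) ?_
    simpa using hw_lim.mul_const ((c₀ * ‖z‖) ^ 2)
  have h_lim : Filter.Tendsto (fun n => σ z z / (σ (w n) (w n) * σ (ξ n) (ξ n)))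
      Filter.atTop Filter.atTop := by
    simpa only [div_eq_mul_inv, Function.comp_def] using
      (tendsto_inv_nhdsGT_zero.comp h_prod).const_mul_atTop (h_posdef z hz0)
  exact ⟨hξ0, h_bracket, h_lim, h_lim.const_mul_atTop_of_neg (by norm_num)⟩
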